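/- (Lindenbaum's Lemma) Suppose the language is countable, and X and Y are nonempty sets of formulas with X ⊬ Y. Then there exist sets X′ and Y′ of formulas with X ⊆ X′, Y ⊆ Y′, X′ ∪ Y′ equal to the whole set of formulas, X′ ⊬ Y′, X′ a prime theory, and Y′ closed under disjunction (A∨B ∈ Y′ whenever A, B ∈ Y′). -/

import Mathlib

inductive Formula (α : Type) : Type
  | atom : α → Formula α
  | neg : Formula α → Formula α
  | conj : Formula α → Formula α → Formula α
  | disj : Formula α → Formula α → Formula α
  | imp : Formula α → Formula α → Formula α

inductive Prov {α : Type} : Formula α → Prop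
  | a1 (A : Formula α) : Prov (A.imp A)
  | a2l (A B : Formula α) : Prov (A.imp (A.disj B))
  | a2r (A B : Formula α) : Prov (B.imp (A.disj B))
  | a3l (A B : Formula α) : Prov ((A.conj B).imp A)
  | a3r (A B : Formula α) : Prov ((A.conj B).imp B)
  | a4 (A B C : Formula α) : Prov (((A.imp C).conj (B.imp C)).imp ((A.disj B).imp C))
  | a5 (A B C : Formula α) : Prov (((A.imp B).conj (A.imp C)).imp (A.imp (B.conj C)))
  | a6 (A B C : Formula α) : Prov ((A.conj (B.disj C)).imp ((A.conj B).disj C))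
  | a7l (A B : Formula α) : Prov ((A.disj B).neg.imp (A.neg.conj B.neg))
  | a7r (A B : Formula α) : Prov ((A.neg.conj B.neg).imp (A.disj B).neg)
  | a8l (A B : Formula α) : Prov ((A.conj B).neg.imp (A.neg.disj B.neg))
  | a8r (A B : Formula α) : Prov ((A.neg.disj B.neg).imp (A.conj B).neg)
  | a9l (A : Formula α) : Prov (A.imp A.neg.neg)
  | a9r (A : Formula α) : Prov (A.neg.neg.imp A)
  | a10 (A B C : Formula α) :
      Prov (((A.disj B).imp C).neg.imp ((A.imp C).neg.disj ((B.imp C).neg)))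
  | a11 (A B C : Formula α) :
      Prov ((A.imp (B.conj C)).neg.imp ((A.imp B).neg.disj ((A.imp C).neg)))
  | r1 {A B : Formula α} : Prov A → Prov (A.imp B) → Prov B
  | r2 {A B : Formula α} : Prov A → Prov B → Prov (A.conj B)
  | r3 {A B : Formula α} (C : Formula α) : Prov (A.imp B) → Prov ((C.imp A).imp (C.imp B))
  | r4 {A B : Formula α} (C : Formula α) : Prov (A.imp B) → Prov ((B.imp C).imp (A.imp C))
  | r5 {A B : Formula α} (C : Formula α) :
      Prov (A.imp B) → Prov ((A.imp C).neg.imp ((B.imp C).neg))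
  | r6 {A B : Formula α} (C : Formula α) :
      Prov (A.neg.imp B.neg) → Prov ((C.imp A).neg.imp ((C.imp B).neg))

def conjList {α : Type} : Formula α → List (Formula α) → Formula α
  | A, [] => A
  | A, B :: l => conjList (A.conj B) l

def disjList {α : Type} : Formula α → List (Formula α) → Formula α
  | A, [] => A
  | A, B :: l => disjList (A.disj B) l

/-- `X ⊢ B` : some finite nonempty conjunction of members of `X` provably implies `B`. -/
def SetProv {α : Type} (X : Set (Formula α)) (B : Formula α) : Prop :=
  ∃ (A : Formula α) (l : List (Formula α)),
    A ∈ X ∧ (∀ C ∈ l, C ∈ X) ∧ Prov ((conjList A l).imp B)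

/-- `X ⊢ Y` : `X` proves some finite nonempty disjunction of members of `Y`. -/
def SetProvSet {α : Type} (X Y : Set (Formula α)) : Prop :=
  ∃ (B : Formula α) (l : List (Formula α)),
    B ∈ Y ∧ (∀ C ∈ l, C ∈ Y) ∧ SetProv X (disjList B l)

def IsTheory {α : Type} (X : Set (Formula α)) : Prop :=
  X.Nonempty ∧ ∀ B, SetProv X B → B ∈ X

def IsPrime {α : Type} (X : Set (Formula α)) : Prop :=
  ∀ A B : Formula α, A.disj B ∈ X ↔ (A ∈ X ∨ B ∈ X)

namespace Prov

variable {α : Type} {A B C D : Formula α}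

theorem trans (h₁ : Prov (A.imp B)) (h₂ : Prov (B.imp C)) : Prov (A.imp C) :=
  r1 h₂ (r4 C h₁)

theorem imp_conj (h₁ : Prov (A.imp B)) (h₂ : Prov (A.imp C)) : Prov (A.imp (B.conj C)) :=
  r1 (r2 h₁ h₂) (a5 A B C)

theorem disj_imp (h₁ : Prov (A.imp C)) (h₂ : Prov (B.imp C)) : Prov ((A.disj B).imp C) :=
  r1 (r2 h₁ h₂) (a4 A B C)

theorem conj_mono (h₁ : Prov (A.imp C)) (h₂ : Prov (B.imp D)) :
    Prov ((A.conj B).imp (C.conj D)) :=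
  imp_conj (trans (a3l A B) h₁) (trans (a3r A B) h₂)

theorem conj_disj_imp (h₁ : Prov ((C.conj A).imp D)) (h₂ : Prov ((C.conj B).imp D)) :
    Prov ((C.conj (A.disj B)).imp D) := by
  have swap : Prov ((C.conj (A.disj B)).imp (B.disj (C.conj A))) :=
    trans (a6 C A B) (disj_imp (a2r _ _) (a2l _ _))
  exact trans (trans (imp_conj (a3l _ _) swap) (a6 C B (C.conj A))) (disj_imp h₂ h₁)

theorem imp_conjList {l : List (Formula α)} (hA : Prov (D.imp A))
    (hl : ∀ C ∈ l, Prov (D.imp C)) : Prov (D.imp (conjList A l)) := by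
  induction l generalizing A with
  | nil => exact hA
  | cons B l ih =>
    exact ih (imp_conj hA (hl B (by simp))) fun C hC => hl C (by simp [hC])

theorem conjList_imp_head (A : Formula α) (l : List (Formula α)) :
    Prov ((conjList A l).imp A) := by
  induction l generalizing A with
  | nil => exact a1 A
  | cons B l ih => exact trans (ih (A.conj B)) (a3l A B)

theorem conjList_imp_of_mem (A : Formula α) {l : List (Formula α)} (hC : C ∈ l) :
    Prov ((conjList A l).imp C) := by
  induction l generalizing A with
  | nil => simp at hC
  | cons B l ih =>
    rcases List.mem_cons.1 hC with rfl | hC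
    · exact trans (conjList_imp_head (A.conj C) l) (a3r A C)
    · exact ih (A.conj B) hC

theorem disjList_imp {l : List (Formula α)} (hA : Prov (A.imp D))
    (hl : ∀ C ∈ l, Prov (C.imp D)) : Prov ((disjList A l).imp D) := by
  induction l generalizing A with
  | nil => exact hA
  | cons B l ih =>
    exact ih (disj_imp hA (hl B (by simp))) fun C hC => hl C (by simp [hC])

theorem imp_disjList_head (A : Formula α) (l : List (Formula α)) :
    Prov (A.imp (disjList A l)) := by
  induction l generalizing A with
  | nil => exact a1 A
  | cons B l ih => exact trans (a2l A B) (ih (A.disj B))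

theorem imp_disjList_of_mem (A : Formula α) {l : List (Formula α)} (hC : C ∈ l) :
    Prov (C.imp (disjList A l)) := by
  induction l generalizing A with
  | nil => simp at hC
  | cons B l ih =>
    rcases List.mem_cons.1 hC with rfl | hC
    · exact trans (a2r A C) (imp_disjList_head (A.disj C) l)
    · exact ih (A.disj B) hC

end Prov

namespace SetProv

variable {α : Type} {X : Set (Formula α)} {A B : Formula α}

theorem of_mem (h : A ∈ X) : SetProv X A :=
  ⟨A, [], h, by simp, Prov.a1 A⟩

theorem mp (h : SetProv X A) (hAB : Prov (A.imp B)) : SetProv X B := by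
  obtain ⟨C, l, hC, hl, hA⟩ := h
  exact ⟨C, l, hC, hl, hA.trans hAB⟩

theorem conj (hA : SetProv X A) (hB : SetProv X B) : SetProv X (A.conj B) := by
  obtain ⟨C, l, hC, hl, hA⟩ := hA
  obtain ⟨D, m, hD, hm, hB⟩ := hB
  refine ⟨C, l ++ D :: m, hC, ?_, Prov.imp_conj (Prov.trans ?_ hA) (Prov.trans ?_ hB)⟩
  · intro E hE
    rcases List.mem_append.1 hE with hE | hE
    · exact hl E hE
    · rcases List.mem_cons.1 hE with rfl | hE
      · exact hD
      · exact hm E hE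
  · exact Prov.imp_conjList (Prov.conjList_imp_head _ _)
      fun E hE => Prov.conjList_imp_of_mem _ (by simp [hE])
  · exact Prov.imp_conjList (Prov.conjList_imp_of_mem _ (by simp))
      fun E hE => Prov.conjList_imp_of_mem _ (by simp [hE])

theorem exists_of_insert (hX : X.Nonempty) (h : SetProv (insert A X) B) :
    ∃ C, SetProv X C ∧ Prov ((C.conj A).imp B) := by
  have bound : ∀ l : List (Formula α), (∀ E ∈ l, E ∈ insert A X) →
      ∃ C, SetProv X C ∧ ∀ E ∈ l, Prov ((C.conj A).imp E) := by
    intro l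
    induction l with
    | nil =>
      obtain ⟨C, hC⟩ := hX
      exact fun _ => ⟨C, of_mem hC, by simp⟩
    | cons D l ih =>
      intro hl
      obtain ⟨C, hC, hCl⟩ := ih fun E hE => hl E (by simp [hE])
      rcases hl D (by simp) with rfl | hD
      · refine ⟨C, hC, fun E hE => ?_⟩
        rcases List.mem_cons.1 hE with rfl | hE
        · exact Prov.a3r _ _
        · exact hCl E hE
      · refine ⟨C.conj D, hC.conj (of_mem hD), fun E hE => ?_⟩
        rcases List.mem_cons.1 hE with rfl | hE
        · exact (Prov.a3l _ _).trans (Prov.a3r _ _)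
        · exact (Prov.conj_mono (Prov.a3l _ _) (Prov.a1 _)).trans (hCl E hE)
  obtain ⟨D, l, hD, hl, hB⟩ := h
  obtain ⟨C, hC, hCl⟩ := bound (D :: l) (by simpa using ⟨hD, hl⟩)
  exact ⟨C, hC, (Prov.imp_conjList (hCl D (by simp)) fun E hE => hCl E (by simp [hE])).trans hB⟩

theorem exists_mem_of_sUnion {c : Set (Set (Formula α))} (hc : IsChain (· ⊆ ·) c)
    (h : SetProv (⋃₀ c) B) : ∃ Z ∈ c, SetProv Z B := by
  obtain ⟨A, l, ⟨Z, hZ, hA⟩, hl, hB⟩ := h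
  have bound : ∃ W ∈ c, Z ⊆ W ∧ ∀ E ∈ l, E ∈ W := by
    clear hB
    induction l with
    | nil => exact ⟨Z, hZ, subset_rfl, by simp⟩
    | cons D l ih =>
      obtain ⟨W, hW, hZW, hlW⟩ := ih fun E hE => hl E (by simp [hE])
      obtain ⟨V, hV, hDV⟩ := hl D (by simp)
      rcases hc.total hW hV with hWV | hVW
      · exact ⟨V, hV, hZW.trans hWV, by simpa using ⟨hDV, fun E hE => hWV (hlW E hE)⟩⟩
      · exact ⟨W, hW, hZW, by simpa using ⟨hVW hDV, hlW⟩⟩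
  obtain ⟨W, hW, hZW, hlW⟩ := bound
  exact ⟨W, hW, A, l, hZW hA, hlW, hB⟩

end SetProv

theorem IsPrime.exists_mem_of_disjList_mem {α : Type} {X : Set (Formula α)} (hX : IsPrime X)
    {A : Formula α} {l : List (Formula α)} (h : disjList A l ∈ X) :
    A ∈ X ∨ ∃ B ∈ l, B ∈ X := by
  induction l generalizing A with
  | nil => exact Or.inl h
  | cons B l ih =>
    rcases ih h with hAB | ⟨C, hC, hCX⟩
    · rcases (hX A B).1 hAB with hA | hB
      · exact Or.inl hA
      · exact Or.inr ⟨B, by simp, hB⟩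
    · exact Or.inr ⟨C, by simp [hC], hCX⟩

namespace SetProvSet

variable {α : Type} {X Y : Set (Formula α)}

theorem exists_maximal_not (h : ¬ SetProvSet X Y) :
    ∃ X', X ⊆ X' ∧ Maximal (fun Z => ¬ SetProvSet Z Y) X' := by
  refine zorn_subset_nonempty {Z | ¬ SetProvSet Z Y} (fun c hcS hc _ => ?_) X h
  refine ⟨⋃₀ c, ?_, fun Z hZ => Set.subset_sUnion_of_mem hZ⟩
  rintro ⟨B, l, hB, hl, hp⟩
  obtain ⟨Z, hZ, hZp⟩ := hp.exists_mem_of_sUnion hc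
  exact hcS hZ ⟨B, l, hB, hl, hZp⟩

theorem of_mem_disj {A B : Formula α} (hX : X.Nonempty) (hAB : SetProv X (A.disj B))
    (hA : SetProvSet (insert A X) Y) (hB : SetProvSet (insert B X) Y) : SetProvSet X Y := by
  obtain ⟨D, l, hD, hl, hp⟩ := hA
  obtain ⟨E, m, hE, hm, hq⟩ := hB
  obtain ⟨C, hC, hCA⟩ := hp.exists_of_insert hX
  obtain ⟨C', hC', hCB⟩ := hq.exists_of_insert hX
  refine ⟨D, l ++ E :: m, hD, ?_, ((hC.conj hC').conj hAB).mp (Prov.conj_disj_imp ?_ ?_)⟩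
  · intro F hF
    rcases List.mem_append.1 hF with hF | hF
    · exact hl F hF
    · rcases List.mem_cons.1 hF with rfl | hF
      · exact hE
      · exact hm F hF
  · refine ((Prov.conj_mono (Prov.a3l _ _) (Prov.a1 _)).trans hCA).trans ?_
    exact Prov.disjList_imp (Prov.imp_disjList_head _ _)
      fun F hF => Prov.imp_disjList_of_mem _ (by simp [hF])
  · refine ((Prov.conj_mono (Prov.a3r _ _) (Prov.a1 _)).trans hCB).trans ?_
    exact Prov.disjList_imp (Prov.imp_disjList_of_mem _ (by simp))
      fun F hF => Prov.imp_disjList_of_mem _ (by simp [hF])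

end SetProvSet

section Maximal

variable {α : Type} {X Y : Set (Formula α)}

theorem setProvSet_insert_of_maximal (hmax : Maximal (fun Z => ¬ SetProvSet Z Y) X)
    {A : Formula α} (hA : A ∉ X) : SetProvSet (insert A X) Y := by
  by_contra hn
  exact hA (hmax.le_of_ge hn (Set.subset_insert A X) (Set.mem_insert A X))

theorem isTheory_of_maximal (hX : X.Nonempty)
    (hmax : Maximal (fun Z => ¬ SetProvSet Z Y) X) : IsTheory X := by
  refine ⟨hX, fun B hB => ?_⟩
  by_contra hn
  have hins := setProvSet_insert_of_maximal hmax hn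
  exact hmax.prop (SetProvSet.of_mem_disj hX (hB.mp (Prov.a2l B B)) hins hins)

theorem isPrime_of_maximal (hX : X.Nonempty)
    (hmax : Maximal (fun Z => ¬ SetProvSet Z Y) X) : IsPrime X := by
  have hth := isTheory_of_maximal hX hmax
  refine fun A B => ⟨fun hAB => ?_, ?_⟩
  · by_contra! hn
    exact hmax.prop (SetProvSet.of_mem_disj hX (SetProv.of_mem hAB)
      (setProvSet_insert_of_maximal hmax hn.1) (setProvSet_insert_of_maximal hmax hn.2))
  · rintro (hA | hB)
    · exact hth.2 _ ((SetProv.of_mem hA).mp (Prov.a2l A B))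
    · exact hth.2 _ ((SetProv.of_mem hB).mp (Prov.a2r A B))

end Maximal

theorem lindenbaum {α : Type} [Countable α] (X Y : Set (Formula α))
    (hX : X.Nonempty) (hY : Y.Nonempty) (h : ¬ SetProvSet X Y) :
    ∃ X' Y' : Set (Formula α),
      X ⊆ X' ∧ Y ⊆ Y' ∧ X' ∪ Y' = Set.univ ∧ ¬ SetProvSet X' Y' ∧
      IsTheory X' ∧ IsPrime X' ∧
      (∀ A B : Formula α, A ∈ Y' → B ∈ Y' → A.disj B ∈ Y') := by
  obtain ⟨X', hXX', hmax⟩ := SetProvSet.exists_maximal_not h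
  have hth := isTheory_of_maximal (hX.mono hXX') hmax
  have hpr := isPrime_of_maximal (hX.mono hXX') hmax
  refine ⟨X', X'ᶜ, hXX', ?_, Set.union_compl_self X', ?_, hth, hpr, ?_⟩
  · exact fun B hB hBX => hmax.prop ⟨B, [], hB, by simp, SetProv.of_mem hBX⟩
  · rintro ⟨B, l, hB, hl, hp⟩
    rcases hpr.exists_mem_of_disjList_mem (hth.2 _ hp) with hBX | ⟨C, hC, hCX⟩
    · exact hB hBX
    · exact hl C hC hCX
  · intro A B hA hB hAB
    exact ((hpr A B).1 hAB).elim hA hB
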